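/- Let A be a K×K real doubly stochastic matrix, J = 𝟙𝟙ᵀ, and let λ = ‖A − (1/K)J‖ be the ℓ²→ℓ² operator norm of the centered matrix. For a family x : Fin K → ℝ^M with average x̄ = (1/K) Σ_k x_k, define y by y_k = Σ_ℓ A_{ℓk} x_ℓ. Then Σ_k ‖y_k − x̄‖² ≤ λ² · Σ_k ‖x_k − x̄‖², where ‖·‖ is the Euclidean norm on ℝ^M. -/

import Mathlib

open Finset Matrix

/-- The ℓ²→ℓ² operator norm of a square real matrix, i.e. the operator norm of
the induced linear map between Euclidean spaces. -/
noncomputable def l2OpNorm {n : Type*} [Fintype n] [DecidableEq n]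
    (B : Matrix n n ℝ) : ℝ :=
  ‖LinearMap.toContinuousLinearMap (Matrix.toEuclideanLin B)‖

open scoped Matrix.Norms.L2Operator in
lemma l2OpNorm_transpose_bound {K : ℕ} (B : Matrix (Fin K) (Fin K) ℝ) (v : Fin K → ℝ) :
    ∑ k, (∑ l, B l k * v l) ^ 2 ≤ l2OpNorm B ^ 2 * ∑ l, v l ^ 2 := by
  have h1 : l2OpNorm B = ‖Bᴴ‖ := by
    rw [Matrix.l2_opNorm_conjTranspose, Matrix.l2_opNorm_def]; rfl
  have h := Matrix.l2_opNorm_mulVec Bᴴ (WithLp.toLp 2 v)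
  have h2 := pow_le_pow_left₀ (norm_nonneg _) h 2
  rw [mul_pow, ← h1, EuclideanSpace.norm_sq_eq, EuclideanSpace.norm_sq_eq] at h2
  simpa [Matrix.mulVec, dotProduct] using h2

/-- One-step contraction of the network disagreement: with
`λ = ‖A − (1/K)J‖` (ℓ²→ℓ² operator norm) and `y k = ∑ ℓ, A ℓ k • x ℓ`,
`∑ k ‖y k − x̄‖² ≤ λ² ∑ k ‖x k − x̄‖²`. -/
theorem network_disagreement_one_step_contraction
    (K M : ℕ) (hK : 0 < K) (A : Matrix (Fin K) (Fin K) ℝ)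
    (hnonneg : ∀ i j, 0 ≤ A i j)
    (hrow : ∀ i, ∑ j, A i j = 1)
    (hcol : ∀ j, ∑ i, A i j = 1)
    (J : Matrix (Fin K) (Fin K) ℝ) (hJ : ∀ i j, J i j = 1)
    (lam : ℝ) (hlam : lam = l2OpNorm (A - (K : ℝ)⁻¹ • J))
    (x y : Fin K → EuclideanSpace ℝ (Fin M))
    (xbar : EuclideanSpace ℝ (Fin M))
    (hxbar : xbar = (K : ℝ)⁻¹ • ∑ k, x k)
    (hy : ∀ k, y k = ∑ ℓ, A ℓ k • x ℓ) :
    ∑ k, ‖y k - xbar‖ ^ 2 ≤ lam ^ 2 * ∑ k, ‖x k - xbar‖ ^ 2 := by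
  have hK' : (K : ℝ) ≠ 0 := by positivity
  simp only [EuclideanSpace.norm_sq_eq, Real.norm_eq_abs, sq_abs]
  rw [Finset.sum_comm, Finset.sum_comm (f := fun k j => ((x k - xbar).ofLp j) ^ 2),
    Finset.mul_sum]
  refine Finset.sum_le_sum fun j _ => ?_
  have h := l2OpNorm_transpose_bound (A - (K : ℝ)⁻¹ • J) (fun l => (x l - xbar).ofLp j)
  rw [← hlam] at h
  have hb : xbar.ofLp j = (K : ℝ)⁻¹ * ∑ k, (x k).ofLp j := by
    rw [hxbar]; simp
  have hv : ∑ l, (x l - xbar).ofLp j = 0 := by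
    simp [hb, hK']
  refine le_trans (le_of_eq ?_) h
  refine Finset.sum_congr rfl fun k _ => ?_
  congr 1
  have e : ∀ l, (A - (K : ℝ)⁻¹ • J) l k * (x l - xbar).ofLp j
      = A l k * (x l).ofLp j - A l k * xbar.ofLp j - (K : ℝ)⁻¹ * (x l - xbar).ofLp j := by
    intro l
    simp [hJ]; ring
  simp only [e]
  rw [Finset.sum_sub_distrib, Finset.sum_sub_distrib, ← Finset.mul_sum, ← Finset.sum_mul, hv, hcol,
    hy]
  simp
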